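/- arXiv:2210.04260 — 5 statements merged into one kernel-verified Lean document; each statement's English description precedes it below -/
import Mathlib

section
/- Let (Ξ, d) be a metric space, p ≥ 1 a real exponent, ℓ : E × Ξ → ℝ a loss function, θ ∈ E fixed, and ξ ∈ Ξ fixed. For λ ≥ 0 let M(λ) := {ζ ∈ Ξ : ℓ(θ, ζ) − λ·d(ζ, ξ)^p = h(θ, λ, ξ)} denote the set of points attaining the supremum defining h(θ, λ, ξ), and define r(λ) := inf{d(ζ, ξ) : ζ ∈ M(λ)}. If λ, λ' ≥ 0 are such that the suprema defining h(θ, λ, ξ) and h(θ, λ', ξ) are finite and M(λ), M(λ') are nonempty, then |h(θ, λ, ξ) − h(θ, λ', ξ)| ≤ max{r(λ)^p, r(λ')^p} · |λ − λ'|. -/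
/-- The Moreau–Yosida regularization
`h(θ, λ, ξ) = sup_{ζ ∈ Ξ} ( ℓ(θ, ζ) − λ·d(ζ, ξ)^p )`. -/
noncomputable def moreauYosida {Ξ : Type*} [MetricSpace Ξ] {E : Type*}
    (ℓ : E → Ξ → ℝ) (p : ℝ) (θ : E) (lam : ℝ) (ξ : Ξ) : ℝ :=
  sSup (Set.range fun ζ => ℓ θ ζ - lam * dist ζ ξ ^ p)

/-- The set of points attaining the supremum defining the Moreau–Yosida regularization. -/
def attainSet {Ξ : Type*} [MetricSpace Ξ] {E : Type*}
    (ℓ : E → Ξ → ℝ) (p : ℝ) (θ : E) (lam : ℝ) (ξ : Ξ) : Set Ξ :=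
  {ζ : Ξ | ℓ θ ζ - lam * dist ζ ξ ^ p = moreauYosida ℓ p θ lam ξ}

/-- `r(λ)`: the infimum of the distances to `ξ` over the attaining set. -/
noncomputable def attainDist {Ξ : Type*} [MetricSpace Ξ] {E : Type*}
    (ℓ : E → Ξ → ℝ) (p : ℝ) (θ : E) (lam : ℝ) (ξ : Ξ) : ℝ :=
  sInf ((fun ζ => dist ζ ξ) '' attainSet ℓ p θ lam ξ)

theorem my_aux {Ξ : Type*} [MetricSpace Ξ] {E : Type*}
    (p : ℝ) (hp : 1 ≤ p) (ℓ : E → Ξ → ℝ) (θ : E) (ξ : Ξ)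
    (lam lam' : ℝ) (hle : lam ≤ lam')
    (hbd : BddAbove (Set.range fun ζ => ℓ θ ζ - lam * dist ζ ξ ^ p))
    (hbd' : BddAbove (Set.range fun ζ => ℓ θ ζ - lam' * dist ζ ξ ^ p))
    (hM : (attainSet ℓ p θ lam ξ).Nonempty) :
    |moreauYosida ℓ p θ lam ξ - moreauYosida ℓ p θ lam' ξ| ≤
      attainDist ℓ p θ lam ξ ^ p * |lam - lam'| := by
  have h1 : moreauYosida ℓ p θ lam' ξ ≤ moreauYosida ℓ p θ lam ξ := by
    have : Nonempty Ξ := ⟨ξ⟩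
    apply csSup_le (Set.range_nonempty _)
    rintro _ ⟨ζ, rfl⟩
    refine le_trans ?_ (le_csSup hbd ⟨ζ, rfl⟩)
    have : 0 ≤ dist ζ ξ ^ p := Real.rpow_nonneg dist_nonneg p
    have := mul_le_mul_of_nonneg_right hle this
    simp only
    linarith
  rw [abs_of_nonneg (by linarith), abs_of_nonpos (by linarith)]
  have hcl : IsClosed {x : ℝ | moreauYosida ℓ p θ lam ξ - moreauYosida ℓ p θ lam' ξ ≤
      x ^ p * -(lam - lam')} :=
    isClosed_le continuous_const
      ((Real.continuous_rpow_const (by linarith)).mul continuous_const)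
  have hmem := csInf_mem_closure (hM.image (fun ζ => dist ζ ξ))
    ⟨0, by rintro _ ⟨ζ, -, rfl⟩; exact dist_nonneg⟩
  refine closure_minimal ?_ hcl hmem
  rintro _ ⟨ζ, hζ, rfl⟩
  have h2 : ℓ θ ζ - lam' * dist ζ ξ ^ p ≤ moreauYosida ℓ p θ lam' ξ :=
    le_csSup hbd' ⟨ζ, rfl⟩
  have h3 : ℓ θ ζ - lam * dist ζ ξ ^ p = moreauYosida ℓ p θ lam ξ := hζ
  simp only [Set.mem_setOf_eq]
  linarith

theorem stmt1 {Ξ : Type*} [MetricSpace Ξ] {E : Type*}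
    (p : ℝ) (hp : 1 ≤ p) (ℓ : E → Ξ → ℝ) (θ : E) (ξ : Ξ)
    (lam lam' : ℝ) (hlam : 0 ≤ lam) (hlam' : 0 ≤ lam')
    (hbd : BddAbove (Set.range fun ζ => ℓ θ ζ - lam * dist ζ ξ ^ p))
    (hbd' : BddAbove (Set.range fun ζ => ℓ θ ζ - lam' * dist ζ ξ ^ p))
    (hM : (attainSet ℓ p θ lam ξ).Nonempty)
    (hM' : (attainSet ℓ p θ lam' ξ).Nonempty) :
    |moreauYosida ℓ p θ lam ξ - moreauYosida ℓ p θ lam' ξ| ≤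
      max (attainDist ℓ p θ lam ξ ^ p) (attainDist ℓ p θ lam' ξ ^ p) * |lam - lam'| := by
  rcases le_total lam lam' with h | h
  · exact (my_aux p hp ℓ θ ξ lam lam' h hbd hbd' hM).trans
      (mul_le_mul_of_nonneg_right (le_max_left _ _) (abs_nonneg _))
  · rw [abs_sub_comm, abs_sub_comm lam]
    exact (my_aux p hp ℓ θ ξ lam' lam h hbd' hbd hM').trans
      (mul_le_mul_of_nonneg_right (le_max_right _ _) (abs_nonneg _))
end

section
/- Let (Ξ, d) be a metric space, p ≥ 1 a real exponent, ℓ : E × Ξ → ℝ a loss function, θ ∈ E, and ξ₀ ∈ Ξ. Suppose there is a constant C ≥ 0 such that ℓ(θ, ζ) ≤ C·(1 + d(ζ, ξ₀)^p) for all ζ ∈ Ξ. Then for every ξ ∈ Ξ, the Moreau–Yosida regularization at λ = 2^{p−1}·C satisfies h(θ, 2^{p−1}·C, ξ) ≤ C·(1 + 2^{p−1}·d(ξ, ξ₀)^p). -/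
theorem stmt3 {Ξ : Type*} [MetricSpace Ξ] [Nonempty Ξ] {E : Type*}
    (p : ℝ) (hp : 1 ≤ p) (ℓ : E → Ξ → ℝ) (θ : E) (ξ₀ : Ξ)
    (C : ℝ) (hC : 0 ≤ C)
    (hgrowth : ∀ ζ, ℓ θ ζ ≤ C * (1 + dist ζ ξ₀ ^ p)) :
    ∀ ξ : Ξ, moreauYosida ℓ p θ ((2 : ℝ) ^ (p - 1) * C) ξ ≤
      C * (1 + (2 : ℝ) ^ (p - 1) * dist ξ ξ₀ ^ p) := by
  intro ξ
  unfold moreauYosida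
  apply csSup_le (Set.range_nonempty _)
  rintro _ ⟨ζ, rfl⟩
  have h1 : dist ζ ξ₀ ^ p ≤ (dist ζ ξ + dist ξ ξ₀) ^ p :=
    Real.rpow_le_rpow dist_nonneg (dist_triangle _ _ _) (by linarith)
  have h2 : (dist ζ ξ + dist ξ ξ₀) ^ p ≤
      (2 : ℝ) ^ (p - 1) * (dist ζ ξ ^ p + dist ξ ξ₀ ^ p) := by
    have := NNReal.rpow_add_le_mul_rpow_add_rpow (nndist ζ ξ) (nndist ξ ξ₀) hp
    exact_mod_cast this
  have h3 := mul_le_mul_of_nonneg_left (h1.trans h2) hC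
  have h4 := hgrowth ζ
  simp only
  linarith
end

section
/- Let (Ξ, d) be a metric space, p ≥ 1 a real exponent, σ > 0, and ℓ : E × Ξ → ℝ a nonnegative loss function. Fix θ ∈ E and ξ₀ ∈ Ξ, and suppose there is C ≥ 0 with ℓ(θ, ζ) ≤ C·(1 + d(ζ, ξ₀)^p) for all ζ ∈ Ξ. Let ξ₁, …, ξ_n ∈ Ξ with ρ := max_{1 ≤ i ≤ n} d(ξ_i, ξ₀), and let w₁, …, w_n ≥ 0 with Σᵢ wᵢ = 1. Define the weighted dual objective G(λ) := λ·σ^p + Σᵢ wᵢ·h(θ, λ, ξᵢ) for λ ≥ 0 (with values in ℝ ∪ {+∞}). If λ* ≥ 0 satisfies G(λ*) ≤ G(λ) for all λ ≥ 0 and G(λ*) is finite, then λ* ≤ C·( 2^{p−1} + (1 + 2^{p−1}·ρ^p)/σ^p ). -/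
/-- The Moreau–Yosida regularization valued in `EReal` (so it may be `+∞`):
`h(θ, λ, ξ) = sup_{ζ ∈ Ξ} ( ℓ(θ, ζ) − λ·d(ζ, ξ)^p )`. -/
noncomputable def moreauYosidaE {Ξ : Type*} [MetricSpace Ξ] {E : Type*}
    (ℓ : E → Ξ → ℝ) (p : ℝ) (θ : E) (lam : ℝ) (ξ : Ξ) : EReal :=
  sSup (Set.range fun ζ => ((ℓ θ ζ - lam * dist ζ ξ ^ p : ℝ) : EReal))

theorem stmt4 {Ξ : Type*} [MetricSpace Ξ] [Nonempty Ξ] {E : Type*}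
    (p σ : ℝ) (hp : 1 ≤ p) (hσ : 0 < σ)
    (ℓ : E → Ξ → ℝ) (hℓnn : ∀ θ ζ, 0 ≤ ℓ θ ζ)
    (θ : E) (ξ₀ : Ξ) (C : ℝ) (hC : 0 ≤ C)
    (hgrowth : ∀ ζ, ℓ θ ζ ≤ C * (1 + dist ζ ξ₀ ^ p))
    {ι : Type*} [Fintype ι] [Nonempty ι] (ξ : ι → Ξ)
    (ρ : ℝ) (hρ : ρ = ⨆ i, dist (ξ i) ξ₀)
    (w : ι → ℝ) (hw : ∀ i, 0 ≤ w i) (hw1 : ∑ i, w i = 1)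
    (G : ℝ → EReal)
    (hG : ∀ lam : ℝ, G lam =
      ((lam * σ ^ p : ℝ) : EReal) + ∑ i, ((w i : ℝ) : EReal) * moreauYosidaE ℓ p θ lam (ξ i))
    (lamstar : ℝ) (hlamstar : 0 ≤ lamstar)
    (hmin : ∀ lam : ℝ, 0 ≤ lam → G lamstar ≤ G lam)
    (hfin : G lamstar ≠ ⊤) :
    lamstar ≤ C * ((2 : ℝ) ^ (p - 1) + (1 + (2 : ℝ) ^ (p - 1) * ρ ^ p) / σ ^ p) := by
  have hp0 : (0:ℝ) < p := by linarith
  have hσp : 0 < σ ^ p := Real.rpow_pos_of_pos hσ p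
  have hρi : ∀ i, dist (ξ i) ξ₀ ≤ ρ := fun i => by
    rw [hρ]
    exact le_ciSup (f := fun i => dist (ξ i) ξ₀) (Set.finite_range _).bddAbove i
  have hK : (0:ℝ) < (2:ℝ) ^ (p - 1) := Real.rpow_pos_of_pos (by norm_num) _
  set K : ℝ := (2:ℝ) ^ (p - 1) with hKdef
  have hup : ∀ i, moreauYosidaE ℓ p θ (C * K) (ξ i) ≤ ((C * (1 + K * ρ ^ p) : ℝ) : EReal) := by
    intro i
    apply sSup_le
    rintro _ ⟨ζ, rfl⟩
    apply EReal.coe_le_coe_iff.mpr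
    have h1 : dist ζ ξ₀ ^ p ≤ K * (dist ζ (ξ i) ^ p + dist (ξ i) ξ₀ ^ p) := by
      refine (Real.rpow_le_rpow dist_nonneg (dist_triangle ζ (ξ i) ξ₀) hp0.le).trans ?_
      have := NNReal.rpow_add_le_mul_rpow_add_rpow (nndist ζ (ξ i)) (nndist (ξ i) ξ₀) hp
      exact_mod_cast this
    have h2 : dist (ξ i) ξ₀ ^ p ≤ ρ ^ p := Real.rpow_le_rpow dist_nonneg (hρi i) hp0.le
    have h3 : dist ζ ξ₀ ^ p ≤ K * (dist ζ (ξ i) ^ p + ρ ^ p) :=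
      h1.trans (by gcongr)
    have h4 := mul_le_mul_of_nonneg_left h3 hC
    have h5 := hgrowth ζ
    nlinarith
  have hlow : ∀ i, (0 : EReal) ≤ moreauYosidaE ℓ p θ lamstar (ξ i) := by
    intro i
    refine le_trans ?_ (le_sSup ⟨ξ i, rfl⟩)
    beta_reduce
    rw [dist_self, Real.zero_rpow hp0.ne', mul_zero, sub_zero]
    exact EReal.coe_nonneg.mpr (hℓnn _ _)
  have hGlow : ((lamstar * σ ^ p : ℝ) : EReal) ≤ G lamstar := by
    rw [hG]
    exact le_add_of_nonneg_right (Finset.sum_nonneg fun i _ =>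
      mul_nonneg (EReal.coe_nonneg.mpr (hw i)) (hlow i))
  have hGup : G (C * K) ≤ ((C * K * σ ^ p + C * (1 + K * ρ ^ p) : ℝ) : EReal) := by
    rw [hG, EReal.coe_add]
    refine add_le_add le_rfl ?_
    have hs : ∑ i, ((w i : ℝ) : EReal) * moreauYosidaE ℓ p θ (C * K) (ξ i)
        ≤ ∑ i, ((w i * (C * (1 + K * ρ ^ p)) : ℝ) : EReal) := by
      refine Finset.sum_le_sum fun i _ => ?_
      rw [EReal.coe_mul]
      exact mul_le_mul_of_nonneg_left (hup i) (EReal.coe_nonneg.mpr (hw i))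
    refine hs.trans (le_of_eq ?_)
    have hc : ∀ (s : Finset ι) (f : ι → ℝ),
        ∑ i ∈ s, ((f i : ℝ) : EReal) = ((∑ i ∈ s, f i : ℝ) : EReal) := by
      intro s f
      classical
      induction s using Finset.induction_on with
      | empty => simp
      | insert a s ha ih => rw [Finset.sum_insert ha, Finset.sum_insert ha, EReal.coe_add, ih]
    rw [hc, ← Finset.sum_mul, hw1, one_mul]
  have hfinal := EReal.coe_le_coe_iff.mp
    (hGlow.trans ((hmin (C * K) (mul_nonneg hC hK.le)).trans hGup))
  have : C * (K + (1 + K * ρ ^ p) / σ ^ p)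
      = (C * K * σ ^ p + C * (1 + K * ρ ^ p)) / σ ^ p := by
    field_simp
  rw [this, le_div_iff₀ hσp]
  exact hfinal
end

section
/- Let (Ξ, d) be a metric space, E a normed vector space, p ≥ 1, and ℓ : E × Ξ → ℝ with a constant L ≥ 0 such that |ℓ(θ, ζ) − ℓ(θ', ζ)| ≤ L·‖θ − θ'‖ for all ζ ∈ Ξ and θ, θ' ∈ E. Fix ξ ∈ Ξ, θ, θ' ∈ E and λ, λ' ≥ 0, and suppose that for each pair (ϑ, μ) ∈ {θ, θ'} × {λ, λ'} the supremum defining h(ϑ, μ, ξ) is finite and attained, and that there is R ≥ 0 such that every attaining point ζ of h(θ, μ, ξ) for μ ∈ {λ, λ'} can be chosen with d(ζ, ξ)^p ≤ R. Then |h(θ, λ, ξ) − h(θ', λ', ξ)| ≤ L·‖θ − θ'‖ + R·|λ − λ'|. -/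
theorem stmt8 {Ξ : Type*} [MetricSpace Ξ] {E : Type*} [NormedAddCommGroup E]
    (p : ℝ) (hp : 1 ≤ p) (ℓ : E → Ξ → ℝ) (L : ℝ) (hL : 0 ≤ L)
    (hLip : ∀ (ζ : Ξ) (θ θ' : E), |ℓ θ ζ - ℓ θ' ζ| ≤ L * ‖θ - θ'‖)
    (ξ : Ξ) (θ θ' : E) (lam lam' : ℝ) (hlam : 0 ≤ lam) (hlam' : 0 ≤ lam')
    (R : ℝ) (hR : 0 ≤ R)
    (hbdd : ∀ ϑ ∈ ({θ, θ'} : Set E), ∀ μ ∈ ({lam, lam'} : Set ℝ),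
      BddAbove (Set.range fun ζ => ℓ ϑ ζ - μ * dist ζ ξ ^ p))
    (hatt : ∀ ϑ ∈ ({θ, θ'} : Set E), ∀ μ ∈ ({lam, lam'} : Set ℝ),
      ∃ ζ : Ξ, ℓ ϑ ζ - μ * dist ζ ξ ^ p = moreauYosida ℓ p ϑ μ ξ)
    (hattR : ∀ μ ∈ ({lam, lam'} : Set ℝ),
      ∃ ζ : Ξ, ℓ θ ζ - μ * dist ζ ξ ^ p = moreauYosida ℓ p θ μ ξ ∧ dist ζ ξ ^ p ≤ R) :
    |moreauYosida ℓ p θ lam ξ - moreauYosida ℓ p θ' lam' ξ| ≤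
      L * ‖θ - θ'‖ + R * |lam - lam'| := by
  have ub : ∀ ϑ ∈ ({θ, θ'} : Set E), ∀ μ ∈ ({lam, lam'} : Set ℝ), ∀ ζ : Ξ,
      ℓ ϑ ζ - μ * dist ζ ξ ^ p ≤ moreauYosida ℓ p ϑ μ ξ := fun ϑ h1 μ h2 ζ =>
    le_csSup (hbdd ϑ h1 μ h2) ⟨ζ, rfl⟩
  have key : ∀ (a b ζ), dist ζ ξ ^ p ≤ R → (a - b) * dist ζ ξ ^ p ≤ R * |a - b| := by
    intro a b ζ h
    have h0 : 0 ≤ dist ζ ξ ^ p := Real.rpow_nonneg dist_nonneg p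
    calc (a - b) * dist ζ ξ ^ p ≤ |a - b| * dist ζ ξ ^ p :=
          mul_le_mul_of_nonneg_right (le_abs_self _) h0
      _ ≤ |a - b| * R := mul_le_mul_of_nonneg_left h (abs_nonneg _)
      _ = R * |a - b| := mul_comm _ _
  obtain ⟨x, hx, hxR⟩ := hattR lam (by simp)
  obtain ⟨y, hy, hyR⟩ := hattR lam' (by simp)
  obtain ⟨z, hz⟩ := hatt θ' (by simp) lam' (by simp)
  have k1 := key lam' lam x hxR
  rw [abs_sub_comm lam' lam] at k1
  have k2 := key lam lam' y hyR
  have u1 := ub θ' (by simp) lam' (by simp) x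
  have u2 := ub θ (by simp) lam' (by simp) z
  have u3 := ub θ (by simp) lam (by simp) y
  have l1 := abs_le.1 (hLip x θ θ')
  have l2 := abs_le.1 (hLip z θ θ')
  rw [abs_le]
  constructor <;> linarith [l1.1, l1.2, l2.1, l2.2]
end

section
/- Let n ≥ 1 and, for each k ∈ {1, …, n}, let a_k, b_k, u_k, v_k ∈ ℝ with 0 ≤ a_k ≤ u_k ≤ b_k. Set A := (1/n)·Σ_k a_k and B := (1/n)·Σ_k b_k, assume A > 0 and B > 0, let N := ⌈log₂ n⌉, and define the grid cells C_{ij} := A_i ∩ B_j for 0 ≤ i, j ≤ N, where A₀ := {k : a_k ≤ A}, A_i := {k : 2^{i−1}A < a_k ≤ 2^i A} for i ≥ 1, B₀ := {k : b_k ≤ B}, and B_j := {k : 2^{j−1}B < b_k ≤ 2^j B} for j ≥ 1. Let ε₁ ≥ 0, and for each nonempty cell C_{ij} let Q_{ij} ⊆ C_{ij} be a nonempty subset satisfying | (1/|Q_{ij}|)·Σ_{k ∈ Q_{ij}} v_k − (1/|C_{ij}|)·Σ_{k ∈ C_{ij}} v_k | ≤ ε₁·(2^{i−1} + 2^{j−1})·A.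 Define weights w_k := |C_{ij}|/(n·|Q_{ij}|) if k ∈ Q_{ij}, and w_k := 0 otherwise. Then Σ_k w_k = 1 and | Σ_k w_k·v_k − (1/n)·Σ_k v_k | ≤ 3·ε₁·A ≤ 3·ε₁·(1/n)·Σ_k u_k. -/
/-- The dyadic layer of indices `k` whose value `x k` lies between `2^{i−1}·X` and `2^i·X`
(for `i ≥ 1`), or is at most `X` (for `i = 0`). -/
noncomputable def dyadicLayer {n : ℕ} (x : Fin n → ℝ) (X : ℝ) (i : ℕ) : Finset (Fin n) :=
  if i = 0 then Finset.univ.filter fun k => x k ≤ X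
  else Finset.univ.filter fun k =>
    (2 : ℝ) ^ ((i : ℤ) - 1) * X < x k ∧ x k ≤ (2 : ℝ) ^ (i : ℤ) * X

/-- The grid cell `C_{ij} = A_i ∩ B_j`. -/
noncomputable def gridCell {n : ℕ} (a b : Fin n → ℝ) (A B : ℝ) (i j : ℕ) : Finset (Fin n) :=
  dyadicLayer a A i ∩ dyadicLayer b B j

theorem mem_layer {n : ℕ} (x : Fin n → ℝ) (X : ℝ) (i : ℕ) (k : Fin n) :
    k ∈ dyadicLayer x X i ↔
      (i = 0 ∨ (2 : ℝ) ^ ((i : ℤ) - 1) * X < x k) ∧ x k ≤ (2 : ℝ) ^ i * X := by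
  unfold dyadicLayer
  split_ifs with h
  · subst h; simp
  · simp [h]

theorem layer_lt {n : ℕ} (x : Fin n → ℝ) (X : ℝ) (hX : 0 < X) (i j : ℕ) (k : Fin n)
    (hi : k ∈ dyadicLayer x X i) (hj : k ∈ dyadicLayer x X j) : j ≤ i := by
  rw [mem_layer] at hi hj
  by_contra h
  push Not at h
  obtain ⟨h0 | h1, -⟩ := hj
  · omega
  · have h2 := lt_of_lt_of_le h1 hi.2
    have h3 : (2 : ℝ) ^ i ≤ (2 : ℝ) ^ ((j : ℤ) - 1) := by
      rw [← zpow_natCast]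
      exact zpow_le_zpow_right₀ (by norm_num) (by omega)
    have := mul_le_mul_of_nonneg_right h3 hX.le
    linarith

theorem layer_exists {n : ℕ} (hn : 1 ≤ n) (x : Fin n → ℝ) (X : ℝ) (hX : 0 < X)
    (hx : ∀ k, 0 ≤ x k) (hXx : X = (∑ k, x k) / n) (k : Fin n) :
    ∃ i, i ≤ Nat.clog 2 n ∧ k ∈ dyadicLayer x X i := by
  classical
  have hn' : (0 : ℝ) < n := by exact_mod_cast hn
  have hk : x k ≤ (2 : ℝ) ^ (Nat.clog 2 n) * X := by
    have h1 : x k ≤ ∑ k, x k := Finset.single_le_sum (fun i _ => hx i) (Finset.mem_univ k)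
    have h2 : ∑ k, x k = n * X := by rw [hXx]; field_simp
    have h3 : (n : ℝ) ≤ (2 : ℝ) ^ (Nat.clog 2 n) := by
      exact_mod_cast Nat.le_pow_clog (by norm_num) n
    have := mul_le_mul_of_nonneg_right h3 hX.le
    linarith
  have hex : ∃ i, x k ≤ (2 : ℝ) ^ i * X := ⟨_, hk⟩
  refine ⟨Nat.find hex, Nat.find_min' hex hk, ?_⟩
  rw [mem_layer]
  refine ⟨?_, Nat.find_spec hex⟩
  rcases Nat.eq_zero_or_pos (Nat.find hex) with h | h
  · exact Or.inl h
  · right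
    have := Nat.find_min hex (m := Nat.find hex - 1) (by omega)
    push Not at this
    rwa [← zpow_natCast, Nat.cast_sub h, Nat.cast_one] at this

theorem layer_bound {n : ℕ} (x : Fin n → ℝ) (X : ℝ) (hX : 0 < X)
    (hx : ∀ k, 0 ≤ x k) (i : ℕ) (k : Fin n) (hk : k ∈ dyadicLayer x X i) :
    (2 : ℝ) ^ ((i : ℤ) - 1) ≤ 1 / 2 + x k / X := by
  rw [mem_layer] at hk
  have h0 : 0 ≤ x k / X := div_nonneg (hx k) hX.le
  rcases hk.1 with h | h
  · subst h
    norm_num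
    exact h0
  · rw [← lt_div_iff₀ hX] at h
    linarith

theorem layer_avg {n : ℕ} (hn : 1 ≤ n) (x : Fin n → ℝ) (X : ℝ) (hX : 0 < X)
    (hXx : X = (∑ k, x k) / n) : ∑ k, (1 / 2 + x k / X) = 3 / 2 * n := by
  have hn' : (0 : ℝ) < n := by exact_mod_cast hn
  have h2 : ∑ k, x k = n * X := by rw [hXx]; field_simp
  rw [Finset.sum_add_distrib, ← Finset.sum_div Finset.univ x X, h2]
  simp
  field_simp
  ring

theorem stmt10 (n : ℕ) (hn : 1 ≤ n) (a b u v : Fin n → ℝ)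
    (habu : ∀ k, 0 ≤ a k ∧ a k ≤ u k ∧ u k ≤ b k)
    (A B : ℝ) (hA : A = (∑ k, a k) / n) (hB : B = (∑ k, b k) / n)
    (hApos : 0 < A) (hBpos : 0 < B)
    (ε₁ : ℝ) (hε₁ : 0 ≤ ε₁)
    (Q : ℕ → ℕ → Finset (Fin n))
    (hQsub : ∀ i j, i ≤ Nat.clog 2 n → j ≤ Nat.clog 2 n → Q i j ⊆ gridCell a b A B i j)
    (hQne : ∀ i j, i ≤ Nat.clog 2 n → j ≤ Nat.clog 2 n →
      (gridCell a b A B i j).Nonempty → (Q i j).Nonempty)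
    (hQapp : ∀ i j, i ≤ Nat.clog 2 n → j ≤ Nat.clog 2 n → (gridCell a b A B i j).Nonempty →
      |(1 / ((Q i j).card : ℝ)) * ∑ k ∈ Q i j, v k -
        (1 / ((gridCell a b A B i j).card : ℝ)) * ∑ k ∈ gridCell a b A B i j, v k| ≤
        ε₁ * ((2 : ℝ) ^ ((i : ℤ) - 1) + (2 : ℝ) ^ ((j : ℤ) - 1)) * A)
    (w : Fin n → ℝ)
    (hw : ∀ (k : Fin n) (i j : ℕ), i ≤ Nat.clog 2 n → j ≤ Nat.clog 2 n → k ∈ Q i j →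
      w k = ((gridCell a b A B i j).card : ℝ) / (n * ((Q i j).card : ℝ)))
    (hw0 : ∀ k : Fin n, (∀ i j, i ≤ Nat.clog 2 n → j ≤ Nat.clog 2 n → k ∉ Q i j) → w k = 0) :
    (∑ k, w k = 1) ∧
    |∑ k, w k * v k - (1 / n : ℝ) * ∑ k, v k| ≤ 3 * ε₁ * A ∧
    3 * ε₁ * A ≤ 3 * ε₁ * ((1 / n : ℝ) * ∑ k, u k) := by
  classical
  have hn' : (0 : ℝ) < n := by exact_mod_cast hn
  have ha : ∀ k, 0 ≤ a k := fun k => (habu k).1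
  have hb : ∀ k, 0 ≤ b k := fun k => by have := habu k; linarith
  choose f hfN hf using layer_exists hn a A hApos ha hA
  choose g hgN hg using layer_exists hn b B hBpos hb hB
  have hcell : ∀ k i j, k ∈ gridCell a b A B i j ↔ (f k, g k) = (i, j) := by
    intro k i j
    unfold gridCell
    rw [Finset.mem_inter, Prod.mk.injEq]
    constructor
    · rintro ⟨h1, h2⟩
      exact ⟨le_antisymm (layer_lt a A hApos _ _ k h1 (hf k)) (layer_lt a A hApos _ _ k (hf k) h1),
        le_antisymm (layer_lt b B hBpos _ _ k h2 (hg k)) (layer_lt b B hBpos _ _ k (hg k) h2)⟩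
    · rintro ⟨rfl, rfl⟩
      exact ⟨hf k, hg k⟩
  set N := Nat.clog 2 n with hN
  set P := Finset.range (N + 1) ×ˢ Finset.range (N + 1) with hP
  have hPm : ∀ p : ℕ × ℕ, p ∈ P → p.1 ≤ N ∧ p.2 ≤ N := by
    intro p hp
    rw [hP, Finset.mem_product, Finset.mem_range, Finset.mem_range] at hp
    omega
  have hsum : ∀ F : Fin n → ℝ, ∑ k, F k = ∑ p ∈ P, ∑ k ∈ gridCell a b A B p.1 p.2, F k := by
    intro F
    rw [← Finset.sum_fiberwise_of_maps_to (s := Finset.univ) (t := P) (g := fun k => (f k, g k))]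
    · refine Finset.sum_congr rfl fun p _ => ?_
      refine Finset.sum_congr ?_ fun _ _ => rfl
      ext k
      simp [hcell]
    · intro k _
      rw [hP, Finset.mem_product, Finset.mem_range, Finset.mem_range]
      exact ⟨Nat.lt_succ_of_le (hfN k), Nat.lt_succ_of_le (hgN k)⟩
  have hwsum : ∀ (F : Fin n → ℝ) (i j : ℕ), i ≤ N → j ≤ N →
      ∑ k ∈ gridCell a b A B i j, w k * F k =
        ((gridCell a b A B i j).card : ℝ) / (n * ((Q i j).card : ℝ)) * ∑ k ∈ Q i j, F k := by
    intro F i j hi hj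
    rw [← Finset.sum_subset (hQsub i j hi hj), Finset.mul_sum]
    · exact Finset.sum_congr rfl fun k hk => by rw [hw k i j hi hj hk]
    · intro k hk hkQ
      rw [hw0 k, zero_mul]
      intro i' j' hi' hj' hk'
      have h1 := (hcell _ _ _).1 (hQsub i' j' hi' hj' hk')
      have h2 := (hcell _ _ _).1 hk
      rw [h1, Prod.mk.injEq] at h2
      obtain ⟨rfl, rfl⟩ := h2
      exact hkQ hk'
  refine ⟨?_, ?_, ?_⟩
  · have h1 : ∑ k : Fin n, (1 / n : ℝ) = 1 := by
      simp
      field_simp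
    rw [← h1, hsum, hsum]
    refine Finset.sum_congr rfl fun p hp => ?_
    obtain ⟨hi, hj⟩ := hPm p hp
    have h2 := hwsum (fun _ => 1) p.1 p.2 hi hj
    simp only [mul_one] at h2
    rw [h2]
    rcases (gridCell a b A B p.1 p.2).eq_empty_or_nonempty with h | h
    · rw [h]; simp
    · have hq : (0 : ℝ) < (Q p.1 p.2).card := by
        exact_mod_cast (hQne p.1 p.2 hi hj h).card_pos
      simp only [Finset.sum_const, nsmul_eq_mul]
      have e : ∀ c q m : ℝ, 0 < q → 0 < m → c / (m * q) * (q * 1) = c * (1 / m) := by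
        intro c q m h1 h2
        field_simp
      exact e _ _ _ hq hn'
  · have key : ∀ p ∈ P, |∑ k ∈ gridCell a b A B p.1 p.2, w k * v k -
        (1 / n : ℝ) * ∑ k ∈ gridCell a b A B p.1 p.2, v k| ≤
        ∑ k ∈ gridCell a b A B p.1 p.2,
          (ε₁ * A / n) * ((1 / 2 + a k / A) + (1 / 2 + b k / B)) := by
      intro p hp
      obtain ⟨hi, hj⟩ := hPm p hp
      rw [hwsum v p.1 p.2 hi hj]
      rcases (gridCell a b A B p.1 p.2).eq_empty_or_nonempty with h | h
      · rw [h]; simp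
      · have hq : (0 : ℝ) < (Q p.1 p.2).card := by
          exact_mod_cast (hQne p.1 p.2 hi hj h).card_pos
        have hc : (0 : ℝ) < (gridCell a b A B p.1 p.2).card := by
          exact_mod_cast h.card_pos
        have happ := hQapp p.1 p.2 hi hj h
        have hE : ∀ k ∈ gridCell a b A B p.1 p.2,
            (ε₁ * A / n) * ((2 : ℝ) ^ ((p.1 : ℤ) - 1) + (2 : ℝ) ^ ((p.2 : ℤ) - 1)) ≤
            (ε₁ * A / n) * ((1 / 2 + a k / A) + (1 / 2 + b k / B)) := by
          intro k hk
          unfold gridCell at hk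
          rw [Finset.mem_inter] at hk
          refine mul_le_mul_of_nonneg_left ?_ (by positivity)
          exact add_le_add (layer_bound a A hApos ha _ k hk.1) (layer_bound b B hBpos hb _ k hk.2)
        refine le_trans ?_ (Finset.sum_le_sum hE)
        rw [Finset.sum_const, nsmul_eq_mul]
        generalize ∑ k ∈ gridCell a b A B p.1 p.2, v k = S at *
        generalize ∑ k ∈ Q p.1 p.2, v k = T at *
        generalize ((gridCell a b A B p.1 p.2).card : ℝ) = c at *
        generalize ((Q p.1 p.2).card : ℝ) = q at *
        have e1 : c / (n * q) * T - 1 / n * S = c / n * (1 / q * T - 1 / c * S) := by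
          field_simp
        rw [e1, abs_mul, abs_of_pos (div_pos hc hn')]
        refine (mul_le_mul_of_nonneg_left happ (div_pos hc hn').le).trans (le_of_eq ?_)
        ring
    rw [hsum (fun k => w k * v k), hsum v, Finset.mul_sum, ← Finset.sum_sub_distrib]
    refine (Finset.abs_sum_le_sum_abs _ _).trans ((Finset.sum_le_sum key).trans (le_of_eq ?_))
    rw [← hsum, ← Finset.mul_sum, Finset.sum_add_distrib, layer_avg hn a A hApos hA,
      layer_avg hn b B hBpos hB]
    field_simp
    ring
  · refine mul_le_mul_of_nonneg_left ?_ (by positivity)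
    rw [hA, div_eq_inv_mul, one_div]
    exact mul_le_mul_of_nonneg_left (Finset.sum_le_sum fun k _ => (habu k).2.1) (by positivity)
end
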